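/- Let Ω ⊂ ℝⁿ be a bounded measurable set and u ∈ C_c^∞(ℝⁿ) with support in Ω, 1 ≤ p < ∞. Then ‖u‖_{L^p(Ω)} ≤ (|Ω|/ω_n)^{1/n} ‖|∇u|‖_{L^p(Ω)}, where ω_n is the volume of the unit ball in ℝⁿ and |Ω| the Lebesgue measure of Ω. -/

import Mathlib

open MeasureTheory Set Metric Module in
/-- Integration in polar coordinates for nonnegative functions. -/
theorem lintegral_eq_lintegral_toSphere {E : Type*} [NormedAddCommGroup E] [NormedSpace ℝ E]
    [Nontrivial E] [FiniteDimensional ℝ E] [MeasurableSpace E] [BorelSpace E]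
    (μ : Measure E) [μ.IsAddHaarMeasure] {f : E → ENNReal} (hf : Measurable f) :
    ∫⁻ z, f z ∂μ = ∫⁻ θ : sphere (0 : E) 1, ∫⁻ r in Ioi (0 : ℝ),
      ENNReal.ofReal (r ^ (finrank ℝ E - 1)) * f (r • (θ : E)) ∂volume ∂μ.toSphere := by
  have hg : Measurable fun q : sphere (0 : E) 1 × Ioi (0 : ℝ) ↦ f ((q.2 : ℝ) • (q.1 : E)) := by
    fun_prop
  calc ∫⁻ z, f z ∂μ = ∫⁻ z : ({(0)}ᶜ : Set E), f z ∂(μ.comap (↑)) := by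
        rw [lintegral_subtype_comap (measurableSet_singleton _).compl, restrict_compl_singleton]
    _ = ∫⁻ z : ({(0)}ᶜ : Set E), (fun q : sphere (0 : E) 1 × Ioi (0 : ℝ) ↦
          f ((q.2 : ℝ) • (q.1 : E))) (homeomorphUnitSphereProd E z) ∂(μ.comap (↑)) := by
        refine lintegral_congr fun z ↦ ?_
        have hz : ‖(z : E)‖ ≠ 0 := norm_ne_zero_iff.2 z.2
        simp [smul_smul, hz]
    _ = ∫⁻ q, f ((q.2 : ℝ) • (q.1 : E)) ∂μ.toSphere.prod (.volumeIoiPow (finrank ℝ E - 1)) :=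
        μ.measurePreserving_homeomorphUnitSphereProd.lintegral_comp hg
    _ = _ := by
        rw [lintegral_prod _ hg.aemeasurable]
        refine lintegral_congr fun θ ↦ ?_
        rw [Measure.volumeIoiPow, lintegral_withDensity_eq_lintegral_mul _ (by fun_prop)
          (by fun_prop)]
        exact lintegral_subtype_comap measurableSet_Ioi
          fun r : ℝ ↦ ENNReal.ofReal (r ^ (finrank ℝ E - 1)) * f (r • (θ : E))

/-- The Riesz kernel of order one, `‖z‖ ^ (1 - d)` where `d` is the dimension of the space. -/
noncomputable def rieszKernel (E : Type*) [NormedAddCommGroup E] [NormedSpace ℝ E]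
    (z : E) : ENNReal :=
  (ENNReal.ofReal (‖z‖ ^ (Module.finrank ℝ E - 1)))⁻¹

namespace rieszKernel

variable {E : Type*} [NormedAddCommGroup E] [NormedSpace ℝ E]

theorem sub_comm (x y : E) : rieszKernel E (x - y) = rieszKernel E (y - x) := by
  simp [rieszKernel, norm_sub_rev]

theorem anti {z w : E} (h : ‖z‖ ≤ ‖w‖) : rieszKernel E w ≤ rieszKernel E z := by
  unfold rieszKernel
  gcongr

variable [MeasurableSpace E] [BorelSpace E]

@[fun_prop]
theorem measurable : Measurable (rieszKernel E) := by
  unfold rieszKernel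
  fun_prop

variable [Nontrivial E] [FiniteDimensional ℝ E]

open MeasureTheory Set Metric Module

theorem lintegral_mul (μ : Measure E) [μ.IsAddHaarMeasure] {f : E → ENNReal} (hf : Measurable f) :
    ∫⁻ z, rieszKernel E z * f z ∂μ =
      ∫⁻ θ : sphere (0 : E) 1, ∫⁻ r in Ioi (0 : ℝ), f (r • (θ : E)) ∂volume ∂μ.toSphere := by
  rw [lintegral_eq_lintegral_toSphere μ (by fun_prop)]
  refine lintegral_congr fun θ ↦ setLIntegral_congr_fun measurableSet_Ioi fun r hr ↦ ?_
  have hr : 0 < r := hr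
  have hpos : 0 < r ^ (finrank ℝ E - 1) := by positivity
  simp only [rieszKernel, norm_smul, norm_eq_of_mem_sphere, mul_one, Real.norm_of_nonneg hr.le]
  rw [← mul_assoc, ENNReal.mul_inv_cancel (by simpa using hpos) ENNReal.ofReal_ne_top, one_mul]

theorem setLIntegral_ball (μ : Measure E) [μ.IsAddHaarMeasure] (R : ℝ) :
    ∫⁻ z in ball 0 R, rieszKernel E z ∂μ = ENNReal.ofReal R * μ.toSphere univ := by
  have h := lintegral_mul μ (f := (ball (0 : E) R).indicator 1)
    (measurable_one.indicator measurableSet_ball)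
  have hθ (θ : sphere (0 : E) 1) :
      ∫⁻ r in Ioi (0 : ℝ), (ball (0 : E) R).indicator 1 (r • (θ : E)) = ENNReal.ofReal R := by
    calc _ = ∫⁻ r in Ioi (0 : ℝ), (Iio R).indicator 1 r := by
          refine setLIntegral_congr_fun measurableSet_Ioi fun r hr ↦ ?_
          have hr : 0 < r := hr
          simp [indicator, norm_smul, abs_of_pos hr]
      _ = _ := by
          rw [lintegral_indicator_one measurableSet_Iio, Measure.restrict_apply measurableSet_Iio,
            Iio_inter_Ioi, Real.volume_Ioo, sub_zero]
  simp only [hθ, lintegral_const] at h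
  rw [← h, ← lintegral_indicator measurableSet_ball]
  refine lintegral_congr fun z ↦ ?_
  by_cases hz : z ∈ ball (0 : E) R <;> simp [hz]

/-- Among sets of given measure, the integral of the Riesz kernel is largest on a ball. -/
theorem setLIntegral_le_ball (μ : Measure E) [μ.IsAddHaarMeasure] {A : Set E}
    (hA : MeasurableSet A) {R : ℝ} (hAR : μ A ≤ μ (ball 0 R)) :
    ∫⁻ z in A, rieszKernel E z ∂μ ≤ ∫⁻ z in ball 0 R, rieszKernel E z ∂μ := by
  set B : Set E := ball 0 R
  have hB : MeasurableSet B := measurableSet_ball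
  obtain hR | hR := le_or_gt R 0
  · have : μ A = 0 := by simpa [B, ball_eq_empty.2 hR] using hAR
    simp [Measure.restrict_eq_zero.2 this]
  have hdiff : μ (A \ B) ≤ μ (B \ A) := by
    have hfin : μ (A ∩ B) ≠ ⊤ := measure_ne_top_of_subset inter_subset_right measure_ball_lt_top.ne
    rw [← measure_inter_add_sdiff A hB, ← measure_inter_add_sdiff B hA, inter_comm B A] at hAR
    exact (ENNReal.add_le_add_iff_left hfin).1 hAR
  obtain ⟨w, hw⟩ := exists_norm_eq E hR.le
  rw [← lintegral_inter_add_sdiff _ A hB, ← lintegral_inter_add_sdiff _ B hA, inter_comm B A]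
  gcongr 1
  calc ∫⁻ z in A \ B, rieszKernel E z ∂μ ≤ ∫⁻ _ in A \ B, rieszKernel E w ∂μ :=
        setLIntegral_mono measurable_const fun z hz ↦ anti (by simpa [hw, B] using hz.2)
    _ = rieszKernel E w * μ (A \ B) := setLIntegral_const _ _
    _ ≤ rieszKernel E w * μ (B \ A) := by gcongr
    _ = ∫⁻ _ in B \ A, rieszKernel E w ∂μ := (setLIntegral_const _ _).symm
    _ ≤ ∫⁻ z in B \ A, rieszKernel E z ∂μ := by
        refine setLIntegral_mono measurable fun z hz ↦ anti ?_
        have := hz.1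
        simp only [B, mem_ball_zero_iff] at this
        exact this.le.trans_eq hw.symm

theorem setLIntegral_sub_le (μ : Measure E) [μ.IsAddHaarMeasure] {Ω : Set E}
    (hΩ : MeasurableSet Ω) {R : ℝ} (hΩR : μ Ω ≤ μ (ball 0 R)) (x : E) :
    ∫⁻ y in Ω, rieszKernel E (y - x) ∂μ ≤ ENNReal.ofReal R * μ.toSphere univ := by
  have hmeas : MeasurableSet ((· + x) ⁻¹' Ω) := measurable_add_const x hΩ
  calc ∫⁻ y in Ω, rieszKernel E (y - x) ∂μ
      = ∫⁻ z in (· + x) ⁻¹' Ω, rieszKernel E z ∂μ := by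
        rw [← (measurePreserving_add_right μ x).setLIntegral_comp_preimage hΩ (by fun_prop)]
        simp
    _ ≤ ∫⁻ z in ball 0 R, rieszKernel E z ∂μ :=
        setLIntegral_le_ball μ hmeas (by rwa [measure_preimage_add_right])
    _ = _ := setLIntegral_ball μ R

/-- A compactly supported `C¹` function is bounded by the Riesz potential of its gradient. -/
theorem toSphere_mul_enorm_le (μ : Measure E) [μ.IsAddHaarMeasure] {F : Type*}
    [NormedAddCommGroup F] [NormedSpace ℝ F] {u : E → F} (hu : ContDiff ℝ 1 u)
    (hc : HasCompactSupport u) (x : E) :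
    μ.toSphere univ * ‖u x‖ₑ ≤ ∫⁻ y, rieszKernel E (x - y) * ‖fderiv ℝ u y‖ₑ ∂μ := by
  have hcont : Continuous (fderiv ℝ u) := hu.continuous_fderiv one_ne_zero
  have hray (θ : sphere (0 : E) 1) :
      ‖u x‖ₑ ≤ ∫⁻ r in Ioi (0 : ℝ), ‖fderiv ℝ u (x - r • (θ : E))‖ₑ := by
    have hθ : ‖(θ : E)‖ = 1 := norm_eq_of_mem_sphere θ
    have hemb : Topology.IsClosedEmbedding fun r : ℝ ↦ x + r • (θ : E) := by
      refine Isometry.isClosedEmbedding (Isometry.of_dist_eq fun r s ↦ ?_)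
      rw [dist_add_left, dist_eq_norm, ← sub_smul, norm_smul, hθ, mul_one, dist_eq_norm]
    have hder (r : ℝ) : deriv (u ∘ fun r : ℝ ↦ x + r • (θ : E)) r
        = fderiv ℝ u (x + r • (θ : E)) θ := by
      refine HasDerivAt.deriv ?_
      refine ((hu.differentiable one_ne_zero) _).hasFDerivAt.comp_hasDerivAt r ?_
      simpa using ((hasDerivAt_id r).smul_const (θ : E)).const_add x
    calc ‖u x‖ₑ = ‖(u ∘ fun r : ℝ ↦ x + r • (θ : E)) 0‖ₑ := by simp
      _ ≤ ∫⁻ r in Iic 0, ‖deriv (u ∘ fun r : ℝ ↦ x + r • (θ : E)) r‖ₑ :=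
          HasCompactSupport.enorm_le_lintegral_Ici_deriv
            (hu.comp (by fun_prop)) (hc.comp_isClosedEmbedding hemb) 0
      _ ≤ ∫⁻ r in Iic (0 : ℝ), ‖fderiv ℝ u (x + r • (θ : E))‖ₑ := by
          refine lintegral_mono fun r ↦ ?_
          rw [hder]
          refine (ContinuousLinearMap.le_opENorm _ _).trans_eq ?_
          rw [← ofReal_norm (θ : E), hθ, ENNReal.ofReal_one, mul_one]
      _ = ∫⁻ r in Ici (0 : ℝ), ‖fderiv ℝ u (x - r • (θ : E))‖ₑ := by
          rw [← (Measure.measurePreserving_neg (volume : Measure ℝ)).setLIntegral_comp_preimage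
            measurableSet_Iic (by fun_prop)]
          simp [sub_eq_add_neg]
      _ = _ := setLIntegral_congr Ioi_ae_eq_Ici.symm
  calc μ.toSphere univ * ‖u x‖ₑ = ∫⁻ _ : sphere (0 : E) 1, ‖u x‖ₑ ∂μ.toSphere := by
        rw [lintegral_const, mul_comm]
    _ ≤ ∫⁻ θ : sphere (0 : E) 1, ∫⁻ r in Ioi (0 : ℝ),
          ‖fderiv ℝ u (x - r • (θ : E))‖ₑ ∂volume ∂μ.toSphere := lintegral_mono hray
    _ = ∫⁻ z, rieszKernel E z * ‖fderiv ℝ u (x - z)‖ₑ ∂μ :=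
        (lintegral_mul μ (f := fun z ↦ ‖fderiv ℝ u (x - z)‖ₑ) (by fun_prop)).symm
    _ = _ := by
        rw [← lintegral_sub_left_eq_self _ x]
        simp

end rieszKernel

open MeasureTheory in
/-- Jensen's inequality for powers with respect to a measure of arbitrary total mass. -/
theorem rpow_lintegral_enorm_le {α F : Type*} [MeasurableSpace α] [NormedAddCommGroup F]
    {ν : Measure α} {f : α → F} (hf : AEStronglyMeasurable f ν) {p : ℝ} (hp : 1 ≤ p) :
    (∫⁻ x, ‖f x‖ₑ ∂ν) ^ p ≤ ν Set.univ ^ (p - 1) * ∫⁻ x, ‖f x‖ₑ ^ p ∂ν := by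
  have hp0 : 0 < p := by linarith
  have h := eLpNorm'_le_eLpNorm'_mul_rpow_measure_univ one_pos hp hf
  simp only [eLpNorm', ENNReal.rpow_one, div_one] at h
  calc (∫⁻ x, ‖f x‖ₑ ∂ν) ^ p
      ≤ ((∫⁻ x, ‖f x‖ₑ ^ p ∂ν) ^ (1 / p) * ν Set.univ ^ (1 - 1 / p)) ^ p := by gcongr
    _ = _ := by
      rw [ENNReal.mul_rpow_of_nonneg _ _ hp0.le, ← ENNReal.rpow_mul, ← ENNReal.rpow_mul,
        one_div_mul_cancel hp0.ne', ENNReal.rpow_one, mul_comm, sub_mul,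
        one_div_mul_cancel hp0.ne', one_mul]

open MeasureTheory in
/-- The Schur test for nonnegative kernels. -/
theorem lintegral_rpow_lintegral_mul_enorm_le {α F : Type*} [MeasurableSpace α]
    [NormedAddCommGroup F] {ν : Measure α} [SFinite ν] {k : α → α → ENNReal}
    (hk : Measurable (Function.uncurry k)) {C : ENNReal}
    (hk₁ : ∀ x, ∫⁻ y, k x y ∂ν ≤ C) (hk₂ : ∀ y, ∫⁻ x, k x y ∂ν ≤ C)
    {f : α → F} (hf : StronglyMeasurable f) {p : ℝ} (hp : 1 ≤ p) :
    ∫⁻ x, (∫⁻ y, k x y * ‖f y‖ₑ ∂ν) ^ p ∂ν ≤ C ^ p * ∫⁻ y, ‖f y‖ₑ ^ p ∂ν := by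
  have hfm : Measurable fun y ↦ ‖f y‖ₑ := hf.enorm
  have hkx (x : α) : Measurable (k x) := hk.of_uncurry_left
  have hky (y : α) : Measurable fun x ↦ k x y := hk.of_uncurry_right
  have hx (x : α) : (∫⁻ y, k x y * ‖f y‖ₑ ∂ν) ^ p
      ≤ C ^ (p - 1) * ∫⁻ y, k x y * ‖f y‖ₑ ^ p ∂ν := by
    have h := rpow_lintegral_enorm_le (ν := ν.withDensity (k x)) hf.aestronglyMeasurable hp
    rw [lintegral_withDensity_eq_lintegral_mul _ (hkx x) hfm,
      lintegral_withDensity_eq_lintegral_mul _ (hkx x) (hfm.pow_const p),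
      withDensity_apply _ .univ, Measure.restrict_univ] at h
    refine h.trans ?_
    exact mul_le_mul' (ENNReal.rpow_le_rpow (hk₁ x) (by linarith)) le_rfl
  have hjoint : Measurable (Function.uncurry fun x y ↦ k x y * ‖f y‖ₑ ^ p) :=
    hk.mul ((hfm.comp measurable_snd).pow_const p)
  calc ∫⁻ x, (∫⁻ y, k x y * ‖f y‖ₑ ∂ν) ^ p ∂ν
      ≤ ∫⁻ x, C ^ (p - 1) * ∫⁻ y, k x y * ‖f y‖ₑ ^ p ∂ν ∂ν := lintegral_mono hx
    _ = C ^ (p - 1) * ∫⁻ y, ∫⁻ x, k x y * ‖f y‖ₑ ^ p ∂ν ∂ν := by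
        rw [lintegral_const_mul _ hjoint.lintegral_prod_right,
          lintegral_lintegral_swap hjoint.aemeasurable]
    _ ≤ C ^ (p - 1) * ∫⁻ y, C * ‖f y‖ₑ ^ p ∂ν := by
        gcongr with y
        rw [lintegral_mul_const _ (hky y)]
        gcongr
        exact hk₂ y
    _ = C ^ p * ∫⁻ y, ‖f y‖ₑ ^ p ∂ν := by
        rw [lintegral_const_mul _ (hfm.pow_const p), ← mul_assoc]
        congr 1
        nth_rewrite 2 [← ENNReal.rpow_one C]
        rw [← ENNReal.rpow_add_of_nonneg _ _ (by linarith) zero_le_one, sub_add_cancel]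

open MeasureTheory Metric Set in
/-- Poincaré's inequality on a set whose measure is at most that of a ball of radius `R`. -/
theorem setLIntegral_enorm_rpow_le_of_measure_le_ball {E F : Type*} [NormedAddCommGroup E]
    [NormedSpace ℝ E] [Nontrivial E] [FiniteDimensional ℝ E] [MeasurableSpace E] [BorelSpace E]
    (μ : Measure E) [μ.IsAddHaarMeasure] [NormedAddCommGroup F] [NormedSpace ℝ F]
    {Ω : Set E} (hΩ : MeasurableSet Ω) {R : ℝ} (hΩR : μ Ω ≤ μ (ball 0 R))
    {u : E → F} (hu : ContDiff ℝ 1 u) (hc : HasCompactSupport u) (hsupp : tsupport u ⊆ Ω)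
    {p : ℝ} (hp : 1 ≤ p) :
    ∫⁻ x in Ω, ‖u x‖ₑ ^ p ∂μ ≤ ENNReal.ofReal R ^ p * ∫⁻ x in Ω, ‖fderiv ℝ u x‖ₑ ^ p ∂μ := by
  have hp0 : 0 ≤ p := by linarith
  have hcont : Continuous (fderiv ℝ u) := hu.continuous_fderiv one_ne_zero
  set S := μ.toSphere univ
  have hS0 : S ≠ 0 := Measure.measure_univ_ne_zero.2 μ.toSphere_ne_zero
  have hS : S ≠ ⊤ := measure_ne_top _ _
  have hpot (x : E) :
      S * ‖u x‖ₑ ≤ ∫⁻ y in Ω, rieszKernel E (x - y) * ‖fderiv ℝ u y‖ₑ ∂μ := by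
    refine (rieszKernel.toSphere_mul_enorm_le μ hu hc x).trans_eq
      (setLIntegral_eq_of_support_subset ?_).symm
    intro y hy
    refine hsupp (support_fderiv_subset ℝ fun h ↦ hy ?_)
    simp [h, ← ofReal_norm]
  have hbound (y : E) := rieszKernel.setLIntegral_sub_le μ hΩ hΩR y
  have hschur := lintegral_rpow_lintegral_mul_enorm_le (ν := μ.restrict Ω)
    (k := fun x y ↦ rieszKernel E (x - y))
    (rieszKernel.measurable.comp measurable_sub)
    (fun x ↦ by simpa only [rieszKernel.sub_comm x] using hbound x) hbound
    hcont.stronglyMeasurable hp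
  have hSp0 : S ^ p ≠ 0 := by simp [hS0, hS]
  have hSp : S ^ p ≠ ⊤ := ENNReal.rpow_ne_top_of_nonneg hp0 hS
  rw [← ENNReal.mul_le_mul_iff_right hSp0 hSp]
  calc S ^ p * ∫⁻ x in Ω, ‖u x‖ₑ ^ p ∂μ = ∫⁻ x in Ω, (S * ‖u x‖ₑ) ^ p ∂μ := by
        rw [← lintegral_const_mul' _ _ hSp]
        simp_rw [ENNReal.mul_rpow_of_nonneg _ _ hp0]
    _ ≤ ∫⁻ x in Ω, (∫⁻ y in Ω, rieszKernel E (x - y) * ‖fderiv ℝ u y‖ₑ ∂μ) ^ p ∂μ := by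
        gcongr with x
        exact hpot x
    _ ≤ (ENNReal.ofReal R * S) ^ p * ∫⁻ x in Ω, ‖fderiv ℝ u x‖ₑ ^ p ∂μ := hschur
    _ = _ := by rw [ENNReal.mul_rpow_of_nonneg _ _ hp0, mul_comm (_ ^ p) (S ^ p), mul_assoc]

open MeasureTheory in
theorem integral_norm_rpow_eq_toReal {α F : Type*} [MeasurableSpace α] [NormedAddCommGroup F]
    {ν : Measure α} {f : α → F} (hf : AEStronglyMeasurable f ν) {p : ℝ} (hp : 0 ≤ p) :
    ∫ x, ‖f x‖ ^ p ∂ν = (∫⁻ x, ‖f x‖ₑ ^ p ∂ν).toReal := by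
  rw [integral_eq_lintegral_of_nonneg_ae (.of_forall fun x ↦ by positivity)
    (hf.norm.aemeasurable.pow_const p).aestronglyMeasurable]
  simp_rw [← ENNReal.ofReal_rpow_of_nonneg (norm_nonneg _) hp, ofReal_norm]

open MeasureTheory in
/-- Poincaré inequality with explicit constant `(|Ω|/ωₙ)^{1/n}`. -/
theorem stmt_8 (n : ℕ) (hn : 0 < n) (Ω : Set (EuclideanSpace ℝ (Fin n)))
    (hΩm : MeasurableSet Ω) (hΩb : Bornology.IsBounded Ω)
    (u : EuclideanSpace ℝ (Fin n) → ℝ) (hu : ContDiff ℝ (⊤ : ℕ∞) u)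
    (hc : HasCompactSupport u) (hsupp : tsupport u ⊆ Ω)
    (p : ℝ) (hp : 1 ≤ p) :
    (∫ x in Ω, |u x| ^ p) ^ (1/p)
      ≤ ((volume Ω).toReal
          / (volume (Metric.ball (0 : EuclideanSpace ℝ (Fin n)) 1)).toReal) ^ ((1:ℝ)/n)
        * (∫ x in Ω, ‖fderiv ℝ u x‖ ^ p) ^ (1/p) := by
  have : Nonempty (Fin n) := ⟨⟨0, hn⟩⟩
  have hp0 : 0 < p := by linarith
  have hu1 : ContDiff ℝ 1 u := hu.of_le (by exact_mod_cast le_top)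
  have hcont : Continuous (fderiv ℝ u) := hu1.continuous_fderiv one_ne_zero
  set ω := volume (Metric.ball (0 : EuclideanSpace ℝ (Fin n)) 1) with hω_def
  have hω : ω ≠ ⊤ := measure_ball_lt_top.ne
  have hω0 : ω ≠ 0 := (Metric.measure_ball_pos _ _ one_pos).ne'
  have hΩ : volume Ω ≠ ⊤ := hΩb.measure_lt_top.ne
  set R : ℝ := ((volume Ω).toReal / ω.toReal) ^ ((1 : ℝ) / n)
  have hR : 0 ≤ R := by positivity
  have hΩR : volume Ω ≤ volume (Metric.ball (0 : EuclideanSpace ℝ (Fin n)) R) := by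
    have hRn : R ^ n = (volume Ω).toReal / ω.toReal := by
      rw [← Real.rpow_natCast, ← Real.rpow_mul (by positivity),
        one_div_mul_cancel (by positivity), Real.rpow_one]
    rw [Measure.addHaar_ball _ _ hR, finrank_euclideanSpace_fin, hRn, ← hω_def,
      ENNReal.ofReal_div_of_pos (ENNReal.toReal_pos hω0 hω), ENNReal.ofReal_toReal hω,
      ENNReal.ofReal_toReal hΩ, ENNReal.div_mul_cancel hω0 hω]
  have hmain := setLIntegral_enorm_rpow_le_of_measure_le_ball volume hΩm hΩR hu1 hc hsupp hp
  have hfin : ∫⁻ x in Ω, ‖fderiv ℝ u x‖ₑ ^ p ≠ ⊤ := by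
    obtain ⟨C, hC⟩ := (hc.fderiv ℝ).exists_bound_of_continuous hcont
    refine (setLIntegral_lt_top_of_le_nnreal hΩ ⟨C.toNNReal ^ p, fun x _ ↦ ?_⟩).ne
    rw [ENNReal.coe_rpow_of_nonneg _ hp0.le]
    gcongr
    rw [← ofReal_norm]
    exact ENNReal.ofReal_le_ofReal (hC x)
  have hreal : ∫ x in Ω, |u x| ^ p ≤ R ^ p * ∫ x in Ω, ‖fderiv ℝ u x‖ ^ p := by
    simp_rw [← Real.norm_eq_abs]
    rw [integral_norm_rpow_eq_toReal hu1.continuous.aestronglyMeasurable hp0.le,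
      integral_norm_rpow_eq_toReal hcont.aestronglyMeasurable hp0.le]
    refine (ENNReal.toReal_mono (ENNReal.mul_ne_top ?_ hfin) hmain).trans_eq ?_
    · exact ENNReal.rpow_ne_top_of_nonneg hp0.le ENNReal.ofReal_ne_top
    · rw [ENNReal.toReal_mul, ← ENNReal.toReal_rpow, ENNReal.toReal_ofReal hR]
  have hI : 0 ≤ ∫ x in Ω, ‖fderiv ℝ u x‖ ^ p := integral_nonneg fun x ↦ by positivity
  have hI' : 0 ≤ ∫ x in Ω, |u x| ^ p := integral_nonneg fun x ↦ by positivity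
  calc (∫ x in Ω, |u x| ^ p) ^ (1 / p)
      ≤ (R ^ p * ∫ x in Ω, ‖fderiv ℝ u x‖ ^ p) ^ (1 / p) := by gcongr
    _ = R * (∫ x in Ω, ‖fderiv ℝ u x‖ ^ p) ^ (1 / p) := by
        rw [Real.mul_rpow (by positivity) hI, ← Real.rpow_mul hR, mul_one_div_cancel hp0.ne',
          Real.rpow_one]
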